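/- (Convergence of the descent algorithm under compactness.) Under the algorithm assumptions stated in the context, let (x_k) be the corresponding sequence of iteration points, suppose additionally that σ_k → 0 and that the set {x_k : k ∈ ℕ} is relatively compact in X. Then every accumulation point of (x_k) is a critical point of f (i.e. satisfies 0 ∈ ∂f(·)); if the sublevel set {x ∈ X : f(x) ≤ f(x₀)} contains only finitely many critical points of f, then (x_k) converges to a critical point of f; and if (x_k) is not convergent, then the set of accumulation points of (x_k) has no isolated points. -/

import Mathlib

open Filter Metric Set Topology MeasureTheory
open scoped RealInnerProductSpace NNReal

variable {X : Type*} [NormedAddCommGroup X] [InnerProductSpace ℝ X] [CompleteSpace X]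

/-- Clarke's generalized directional derivative. -/
noncomputable def clarkeDeriv (f : X → ℝ) (x h : X) : ℝ :=
  Filter.limsup (fun p : X × ℝ => (f (p.1 + p.2 • h) - f p.1) / p.2)
    ((𝓝 x) ×ˢ (𝓝[>] (0:ℝ)))

/-- Clarke's generalized gradient. -/
noncomputable def clarkeGrad (f : X → ℝ) (x : X) : Set X :=
  {a | ∀ h : X, ⟪a, h⟫ ≤ clarkeDeriv f x h}

/-- The gradient of `f` on the closed ball of radius `ε` about `x`. -/
noncomputable def epsGrad (f : X → ℝ) (ε : ℝ) (x : X) : Set X :=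
  closure (convexHull ℝ (⋃ y ∈ Metric.closedBall x ε, clarkeGrad f y))

/-- The directional derivative of `f` on the closed ball of radius `ε` about `x`. -/
noncomputable def epsDeriv (f : X → ℝ) (ε : ℝ) (x h : X) : ℝ :=
  sSup ((fun y => clarkeDeriv f y h) '' Metric.closedBall x ε)

/-- The norm induced by the bilinear form `B k`. -/
noncomputable def normk (B : ℕ → X →L[ℝ] X →L[ℝ] ℝ) (k : ℕ) (u : X) : ℝ :=
  Real.sqrt (B k u u)

/-- Clarke's generalized gradient with respect to the inner product `B k`. -/
noncomputable def gradk (f : X → ℝ) (B : ℕ → X →L[ℝ] X →L[ℝ] ℝ) (k : ℕ) (x : X) : Set X :=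
  {a | ∀ h : X, B k a h ≤ clarkeDeriv f x h}

/-- The gradient of `f` on the `‖·‖ₖ`-ball of radius `ε` about `x`,
taken with respect to the inner product `B k`. -/
noncomputable def epsGradk (f : X → ℝ) (B : ℕ → X →L[ℝ] X →L[ℝ] ℝ) (k : ℕ)
    (ε : ℝ) (x : X) : Set X :=
  closure (convexHull ℝ (⋃ y ∈ {y : X | normk B k (y - x) ≤ ε}, gradk f B k y))

section

variable {H : Type*} [NormedAddCommGroup H] [InnerProductSpace ℝ H]

theorem eventually_abs_quotient_le {f : H → ℝ} (hf : LocallyLipschitz f) (x h : H) :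
    ∃ M : ℝ, ∀ᶠ p : H × ℝ in 𝓝 x ×ˢ 𝓝[>] (0 : ℝ), |(f (p.1 + p.2 • h) - f p.1) / p.2| ≤ M := by
  obtain ⟨K, t, ht, hK⟩ := hf x
  refine ⟨K * ‖h‖, ?_⟩
  have hlim : Tendsto (fun p : H × ℝ => p.1 + p.2 • h) (𝓝 x ×ˢ 𝓝[>] (0 : ℝ)) (𝓝 x) := by
    have hcont : Tendsto (fun p : H × ℝ => p.1 + p.2 • h) (𝓝 (x, 0)) (𝓝 (x + (0 : ℝ) • h)) :=
      Continuous.tendsto (by fun_prop) (x, (0 : ℝ))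
    rw [zero_smul, add_zero, nhds_prod_eq] at hcont
    exact hcont.mono_left (Filter.prod_mono le_rfl nhdsWithin_le_nhds)
  filter_upwards [tendsto_fst.eventually ht, hlim.eventually ht,
    tendsto_snd.eventually self_mem_nhdsWithin] with p hp hph hpos
  have hpos : 0 < p.2 := hpos
  have hle := hK.dist_le_mul _ hph _ hp
  rw [Real.dist_eq, dist_eq_norm, add_sub_cancel_left, norm_smul, Real.norm_of_nonneg hpos.le] at hle
  rw [abs_div, abs_of_pos hpos, div_le_iff₀ hpos]
  linarith

theorem eventually_clarkeDeriv_le {f : H → ℝ} (hf : LocallyLipschitz f) {z h : H} {c : ℝ}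
    (hc : clarkeDeriv f z h < c) : ∀ᶠ y in 𝓝 z, clarkeDeriv f y h ≤ c := by
  obtain ⟨M, hM⟩ := eventually_abs_quotient_le hf z h
  have hlt := eventually_lt_of_limsup_lt hc
    (isBoundedUnder_of_eventually_le (hM.mono fun p hp => (abs_le.1 hp).2))
  obtain ⟨P, hP, Q, hQ, hPQ⟩ := eventually_prod_iff.1 hlt
  filter_upwards [hP.eventually_nhds] with y hy
  obtain ⟨M', hM'⟩ := eventually_abs_quotient_le hf y h
  refine limsup_le_of_le
    (isBoundedUnder_of_eventually_ge (a := -M')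
      (hM'.mono fun p hp => (abs_le.1 hp).1)).isCoboundedUnder_le ?_
  exact eventually_prod_iff.2 ⟨P, hy, Q, hQ, fun hx _ hq => (hPQ hx hq).le⟩

theorem apply_self_nonneg_of_le_normk {B : ℕ → H →L[ℝ] H →L[ℝ] ℝ} {C : ℝ} (hC : 1 ≤ C)
    (hBlow : ∀ k (u : H), (1 / C) * ‖u‖ ≤ normk B k u) (k : ℕ) (u : H) : 0 ≤ B k u u := by
  by_contra! h
  have hu : u ≠ 0 := by
    rintro rfl
    simp at h
  have h1 := hBlow k u
  rw [normk, Real.sqrt_eq_zero_of_nonpos h.le] at h1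
  have : 0 < (1 / C) * ‖u‖ := by positivity
  linarith

theorem normk_smul (B : ℕ → H →L[ℝ] H →L[ℝ] ℝ) (k : ℕ) (t : ℝ) (u : H) :
    normk B k (t • u) = |t| * normk B k u := by
  have : B k (t • u) (t • u) = t ^ 2 * B k u u := by
    simp only [map_smul, smul_apply, smul_eq_mul]
    ring
  rw [normk, this, Real.sqrt_mul (sq_nonneg t), Real.sqrt_sq_eq_abs, normk]

theorem abs_apply_le_normk_mul_normk {B : ℕ → H →L[ℝ] H →L[ℝ] ℝ} {k : ℕ}
    (hsymm : ∀ u v : H, B k u v = B k v u) (hnonneg : ∀ u : H, 0 ≤ B k u u) (u v : H) :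
    |B k u v| ≤ normk B k u * normk B k v := by
  have h := LinearMap.BilinForm.apply_mul_apply_le_of_forall_zero_le (B k).toLinearMap₁₂ hnonneg u v
  have h' : B k u v * B k v u ≤ B k u u * B k v v := h
  rw [← hsymm u v, ← sq] at h'
  rw [normk, normk, ← Real.sqrt_mul (hnonneg u)]
  exact Real.abs_le_sqrt h'

theorem gradk_subset_epsGradk (f : H → ℝ) (B : ℕ → H →L[ℝ] H →L[ℝ] ℝ) (k : ℕ) {ε : ℝ}
    (hε : 0 ≤ ε) (y : H) : gradk f B k y ⊆ epsGradk f B k ε y := by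
  intro a ha
  refine subset_closure (subset_convexHull ℝ _ (mem_iUnion₂.2 ⟨y, ?_, ha⟩))
  simpa [normk] using hε

theorem apply_le_of_mem_epsGradk {f : H → ℝ} {B : ℕ → H →L[ℝ] H →L[ℝ] ℝ} {k : ℕ} {ε c : ℝ}
    {y h : H} (hc : ∀ w, normk B k (w - y) ≤ ε → clarkeDeriv f w h ≤ c) {a : H}
    (ha : a ∈ epsGradk f B k ε y) : B k a h ≤ c := by
  have hlin : IsLinearMap ℝ fun a => B k a h := ⟨by simp, by simp⟩
  have hclosed : IsClosed {a | B k a h ≤ c} :=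
    isClosed_le (by fun_prop) continuous_const
  refine closure_minimal (convexHull_min ?_ (convex_halfSpace_le hlin c)) hclosed ha
  intro b hb
  obtain ⟨w, hw, hb⟩ := mem_iUnion₂.1 hb
  exact (hb h).trans (hc w hw)

/-- Near a noncritical point the approximate gradients are uniformly bounded away from zero. -/
theorem exists_le_normk_of_notMem_clarkeGrad {f : H → ℝ} (hf : LocallyLipschitz f)
    {C : ℝ} (hC : 1 ≤ C) {B : ℕ → H →L[ℝ] H →L[ℝ] ℝ}
    (hBsymm : ∀ k (u v : H), B k u v = B k v u)
    (hBlow : ∀ k (u : H), (1 / C) * ‖u‖ ≤ normk B k u)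
    (hBhigh : ∀ k (u : H), normk B k u ≤ C * ‖u‖)
    {z : H} (hz : (0 : H) ∉ clarkeGrad f z) :
    ∃ η > 0, ∃ r > 0, ∀ k y, dist y z < r → ∀ ε ≤ r, ∀ a ∈ epsGradk f B k ε y,
      η ≤ normk B k a := by
  have hC0 : 0 < C := by linarith
  obtain ⟨h, hh⟩ : ∃ h, clarkeDeriv f z h < 0 := by
    simpa [clarkeGrad] using hz
  obtain ⟨c, hzc, hc⟩ := exists_between hh
  obtain ⟨R, hR, hball⟩ := Metric.eventually_nhds_iff.1 (eventually_clarkeDeriv_le hf hzc)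
  refine ⟨-c / (C * ‖h‖ + 1), by have := neg_pos.2 hc; positivity, R / (2 * C), by positivity, ?_⟩
  intro k y hy ε hε a ha
  have hah : B k a h ≤ c := by
    refine apply_le_of_mem_epsGradk (fun w hw => hball ?_) ha
    have h1 := (hBlow k (w - y)).trans (hw.trans hε)
    rw [one_div, inv_mul_le_iff₀ hC0, ← dist_eq_norm] at h1
    have h2 : C * (R / (2 * C)) = R / 2 := by field_simp
    have h3 : R / (2 * C) ≤ R / 2 := by gcongr; linarith
    linarith [dist_triangle w y z]
  have hcs := abs_apply_le_normk_mul_normk (hBsymm k)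
    (apply_self_nonneg_of_le_normk hC hBlow k) a h
  have hn : 0 ≤ normk B k a := Real.sqrt_nonneg _
  rw [div_le_iff₀ (by positivity)]
  nlinarith [neg_abs_le (B k a h), mul_le_mul_of_nonneg_left (hBhigh k h) hn]

/-- A sequence whose steps near a cluster point are dominated by the decrease of a convergent
antitone sequence converges to that cluster point. -/
theorem tendsto_of_dist_le_mul_sub {E : Type*} [PseudoMetricSpace E] {x : ℕ → E} {g : ℕ → ℝ}
    {L c ρ : ℝ} {z : E} (hg : Antitone g) (hgL : Tendsto g atTop (𝓝 L)) (hc : 0 ≤ c) (hρ : 0 < ρ)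
    {φ : ℕ → ℕ} (hφ : StrictMono φ) (hx : Tendsto (fun n => x (φ n)) atTop (𝓝 z))
    (hstep : ∀ᶠ k in atTop, dist (x k) z < ρ → dist (x (k + 1)) (x k) ≤ c * (g k - g (k + 1))) :
    Tendsto x atTop (𝓝 z) := by
  rw [Metric.tendsto_atTop]
  intro e he
  obtain ⟨N, hN⟩ := eventually_atTop.1 hstep
  have hd : 0 < min e ρ / 2 := by positivity
  have hsmall : Tendsto (fun k => c * (g k - L)) atTop (𝓝 0) := by
    simpa using (hgL.sub_const L).const_mul c
  obtain ⟨n, hxn, hgn, hNn⟩ := ((hx.eventually (Metric.ball_mem_nhds z hd)).and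
    ((hφ.tendsto_atTop.eventually (hsmall.eventually_lt_const hd)).and
      (hφ.tendsto_atTop.eventually_ge_atTop N))).exists
  have hxn : dist (x (φ n)) z < min e ρ / 2 := hxn
  have hbound {m : ℕ} (h : dist (x m) z < min e ρ / 2 + c * (g (φ n) - g m)) :
      dist (x m) z < min e ρ := by
    have : c * (g (φ n) - g m) ≤ c * (g (φ n) - L) := by
      gcongr
      exact hg.le_of_tendsto hgL m
    linarith
  have key : ∀ m ≥ φ n, dist (x m) z < min e ρ / 2 + c * (g (φ n) - g m) := by
    intro m hm
    induction m, hm using Nat.le_induction with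
    | base => simpa using hxn
    | succ m hm ih =>
      have := hN m (hNn.trans hm) ((hbound ih).trans_le (min_le_right _ _))
      linarith [dist_triangle (x (m + 1)) (x m) z]
  exact ⟨φ n, fun m hm => (hbound (key m hm)).trans_le (min_le_left _ _)⟩

/-- A relatively compact sequence with vanishing steps converges to any isolated cluster point. -/
theorem tendsto_of_isolated_clusterPt {E : Type*} [MetricSpace E] {x : ℕ → E} {z : E} {r : ℝ}
    (hcpt : IsCompact (closure (range x)))
    (hstep : Tendsto (fun k => dist (x (k + 1)) (x k)) atTop (𝓝 0)) (hr : 0 < r)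
    {φ : ℕ → ℕ} (hφ : StrictMono φ) (hx : Tendsto (fun n => x (φ n)) atTop (𝓝 z))
    (hiso : ∀ w, (∃ ψ : ℕ → ℕ, StrictMono ψ ∧ Tendsto (fun n => x (ψ n)) atTop (𝓝 w)) →
      w ≠ z → r ≤ dist w z) :
    Tendsto x atTop (𝓝 z) := by
  by_contra hnot
  obtain ⟨e, he, her, hfreq⟩ : ∃ e > 0, e < r ∧ ∃ᶠ k in atTop, e / 2 ≤ dist (x k) z := by
    rw [Metric.tendsto_nhds] at hnot
    push Not at hnot
    obtain ⟨e, he, hfreq⟩ := hnot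
    refine ⟨min e (r / 2), by positivity, (min_le_right _ _).trans_lt (by linarith), ?_⟩
    refine hfreq.mono fun k hk => ?_
    linarith [min_le_left e (r / 2), show 0 < min e (r / 2) by positivity]
  have hannulus : ∃ᶠ k in atTop,
      x k ∈ closure (range x) ∩ {w | e / 2 ≤ dist w z ∧ dist w z ≤ e} := by
    rw [frequently_atTop]
    intro N
    obtain ⟨M, hM⟩ := eventually_atTop.1 (hstep.eventually_lt_const (half_pos he))
    obtain ⟨n, hxn, hn⟩ := ((hx.eventually (Metric.ball_mem_nhds z (half_pos he))).and
      (hφ.tendsto_atTop.eventually_ge_atTop (max N M))).exists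
    obtain ⟨m', hm', hxm'⟩ := frequently_atTop.1 hfreq (φ n)
    by_contra! hno
    have key : ∀ m ≥ φ n, dist (x m) z < e / 2 := by
      intro m hm
      induction m, hm using Nat.le_induction with
      | base => exact hxn
      | succ m hm ih =>
        by_contra! hge
        have hs := hM m ((le_max_right _ _).trans (hn.trans hm))
        refine hno (m + 1) (((le_max_left _ _).trans (hn.trans hm)).trans m.le_succ)
          ⟨subset_closure (mem_range_self _), hge, ?_⟩
        linarith [dist_triangle (x (m + 1)) (x m) z]
    exact (key m' hm').not_ge hxm'
  have hclosed : IsClosed {w | e / 2 ≤ dist w z ∧ dist w z ≤ e} :=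
    (isClosed_le continuous_const (continuous_id.dist continuous_const)).inter
      (isClosed_le (continuous_id.dist continuous_const) continuous_const)
  obtain ⟨w, ⟨-, hw₁, hw₂⟩, ψ, hψ, hxψ⟩ := (hcpt.inter_right hclosed).tendsto_subseq' hannulus
  have hwz : w ≠ z := dist_pos.1 ((half_pos he).trans_le hw₁)
  linarith [hiso w ⟨ψ, hψ, hxψ⟩ hwz]

end

/-- Proposition 3.11: under compactness, every accumulation point is critical; with
finitely many critical points in the sublevel set the iterates converge to a critical
point; and a non-convergent sequence has no isolated accumulation points. -/
theorem convergence_under_compactness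
    (f : X → ℝ) (hf : LocallyLipschitz f)
    (C : ℝ) (hC : 1 ≤ C)
    (B : ℕ → X →L[ℝ] X →L[ℝ] ℝ)
    (hBsymm : ∀ k (u v : X), B k u v = B k v u)
    (hBlow : ∀ k (u : X), (1 / C) * ‖u‖ ≤ normk B k u)
    (hBhigh : ∀ k (u : X), normk B k u ≤ C * ‖u‖)
    (δ : ℝ) (hδ : δ ∈ Set.Ioo (0:ℝ) 1)
    (T₁ T₂ : ℝ → ℝ)
    (hT₁pos : ∀ t : ℝ, 0 < t → 0 < T₁ t) (hT₁mono : MonotoneOn T₁ (Set.Ioi 0))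
    (hT₁lim : Tendsto T₁ (𝓝[>] (0:ℝ)) (𝓝 0))
    (hT₂pos : ∀ t : ℝ, 0 < t → 0 < T₂ t) (hT₂mono : MonotoneOn T₂ (Set.Ioi 0))
    (hT₂lim : ∀ t : ℝ, 0 < t → Tendsto (fun n => T₂^[n] t) atTop (𝓝 0))
    (G : ℝ → ℝ → ℝ) (hGpos : ∀ s t : ℝ, 0 < s → 0 < t → 0 < G s t)
    (hG : (∀ s t : ℕ → ℝ, (∀ k, 0 < s k) → (∀ k, 0 < t k) →
            Tendsto (fun k => G (s k) (t k)) atTop (𝓝 0) →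
            Tendsto s atTop (𝓝 0)) ∨
          (∀ s₀ : ℝ, 0 < s₀ → ∃ t₀ > (0:ℝ), ∀ s t : ℝ, s₀ < s → 0 < t → t < t₀ →
            t ≤ G s t))
    (x : ℕ → X) (εs : ℕ → ℝ) (hεspos : ∀ k, 0 < εs k)
    (σ : ℕ → ℝ) (hσpos : ∀ k, 0 < σ k) (ik : ℕ → ℕ)
    (a : ℕ → X) (hak : ∀ k, a k ∈ gradk f B k (x k))
    (εki : ℕ → ℕ → ℝ)
    (hεki0 : ∀ k, G (normk B k (a k)) (εs k) ≤ εki k 0)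
    (hεkiS : ∀ k, ∀ i < ik k, εki k (i+1) = T₂ (εki k i))
    (hnull : ∀ k, ∀ i < ik k,
      ∃ a' ∈ epsGradk f B k (εki k i) (x k), normk B k a' < T₁ (εki k i))
    (hεsS : ∀ k, εs (k+1) = εki k (ik k))
    (ahat : ℕ → X) (hahatmem : ∀ k, ahat k ∈ epsGradk f B k (εs (k+1)) (x k))
    (hahatnotnull : ∀ k, T₁ (εs (k+1)) ≤ normk B k (ahat k))
    (hσε : ∀ k, εs (k+1) ≤ σ k)
    (hxS : ∀ k, x (k+1) = x k - (σ k / normk B k (ahat k)) • ahat k)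
    (hdesc : ∀ k, f (x (k+1)) - f (x k) ≤ -δ * σ k * normk B k (ahat k))
    (hσ0 : Tendsto σ atTop (𝓝 0))
    (hcpt : IsCompact (closure (Set.range x))) :
    (∀ z : X, (∃ φ : ℕ → ℕ, StrictMono φ ∧ Tendsto (fun n => x (φ n)) atTop (𝓝 z)) →
      (0 : X) ∈ clarkeGrad f z) ∧
    ({z : X | f z ≤ f (x 0) ∧ (0 : X) ∈ clarkeGrad f z}.Finite →
      ∃ z : X, (0 : X) ∈ clarkeGrad f z ∧ Tendsto x atTop (𝓝 z)) ∧
    ((¬ ∃ z : X, Tendsto x atTop (𝓝 z)) →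
      ∀ z : X, (∃ φ : ℕ → ℕ, StrictMono φ ∧ Tendsto (fun n => x (φ n)) atTop (𝓝 z)) →
        ∀ r : ℝ, 0 < r →
          ∃ w : X, (∃ ψ : ℕ → ℕ, StrictMono ψ ∧ Tendsto (fun n => x (ψ n)) atTop (𝓝 w)) ∧
            w ≠ z ∧ dist w z < r) := by
  have hC0 : 0 < C := by linarith
  have hεs0 : Tendsto εs atTop (𝓝 0) := by
    rw [← tendsto_add_atTop_iff_nat 1]
    exact squeeze_zero (fun k => (hεspos _).le) hσε hσ0
  have hahat (k : ℕ) : 0 < normk B k (ahat k) := (hT₁pos _ (hεspos _)).trans_le (hahatnotnull k)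
  have hfanti : Antitone fun k => f (x k) := by
    refine antitone_nat_of_succ_le fun k => ?_
    have := mul_pos (mul_pos hδ.1 (hσpos k)) (hahat k)
    linarith [hdesc k]
  have hdist (k : ℕ) : dist (x (k + 1)) (x k) ≤ C * σ k := by
    have h := hBlow k (x (k + 1) - x k)
    have hstep : x (k + 1) - x k = (-(σ k / normk B k (ahat k))) • ahat k := by
      rw [hxS k]
      module
    have hval : normk B k (x (k + 1) - x k) = σ k := by
      rw [hstep, normk_smul, abs_neg, abs_of_pos (div_pos (hσpos k) (hahat k)),
        div_mul_cancel₀ _ (hahat k).ne']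
    rwa [hval, one_div, inv_mul_le_iff₀ hC0, ← dist_eq_norm] at h
  have hdist0 : Tendsto (fun k => dist (x (k + 1)) (x k)) atTop (𝓝 0) :=
    squeeze_zero (fun _ => dist_nonneg) hdist (by simpa using hσ0.const_mul C)
  have hlim {z : X} {φ : ℕ → ℕ} (hφ : StrictMono φ)
      (hx : Tendsto (fun n => x (φ n)) atTop (𝓝 z)) :
      Tendsto (fun k => f (x k)) atTop (𝓝 (f z)) :=
    (tendsto_iff_tendsto_subseq_of_antitone hfanti hφ.tendsto_atTop).2
      ((hf.continuous.tendsto z).comp hx)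
  have hcrit : ∀ z : X, (∃ φ : ℕ → ℕ, StrictMono φ ∧ Tendsto (fun n => x (φ n)) atTop (𝓝 z)) →
      (0 : X) ∈ clarkeGrad f z := by
    rintro z ⟨φ, hφ, hxφ⟩
    by_contra hz
    obtain ⟨η, hη, r, hr, hsep⟩ :=
      exists_le_normk_of_notMem_clarkeGrad hf hC hBsymm hBlow hBhigh hz
    have hεsr : ∀ᶠ k in atTop, εs (k + 1) < r :=
      ((tendsto_add_atTop_iff_nat 1).2 hεs0).eventually_lt_const hr
    have hxz : Tendsto x atTop (𝓝 z) := by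
      refine tendsto_of_dist_le_mul_sub (c := C / (δ * η)) hfanti (hlim hφ hxφ)
        (by have := hδ.1; positivity) hr hφ hxφ ?_
      filter_upwards [hεsr] with k hk hxk
      have hle := hsep k (x k) hxk _ hk.le _ (hahatmem k)
      have hδη : 0 < δ * η := mul_pos hδ.1 hη
      have h1 : δ * σ k * η ≤ δ * σ k * normk B k (ahat k) :=
        mul_le_mul_of_nonneg_left hle (mul_pos hδ.1 (hσpos k)).le
      have h2 : σ k ≤ (f (x k) - f (x (k + 1))) / (δ * η) := by
        rw [le_div_iff₀ hδη]
        linarith [hdesc k]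
      calc dist (x (k + 1)) (x k) ≤ C * σ k := hdist k
        _ ≤ C * ((f (x k) - f (x (k + 1))) / (δ * η)) := by gcongr
        _ = C / (δ * η) * (f (x k) - f (x (k + 1))) := by ring
    have hclose : ∀ᶠ k in atTop, dist (x k) z < r := hxz.eventually (Metric.ball_mem_nhds z hr)
    have haη : ∀ᶠ k in atTop, η ≤ normk B k (a k) := by
      filter_upwards [hclose] with k hk
      exact hsep k (x k) hk 0 hr.le _ (gradk_subset_epsGradk f B k le_rfl _ (hak k))
    obtain ⟨t, ht, htr, hT₁t⟩ : ∃ t > 0, t ≤ r ∧ T₁ t < η := by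
      have h1 : ∀ᶠ t in 𝓝[>] (0 : ℝ), T₁ t < η := hT₁lim.eventually_lt_const hη
      have h2 : ∀ᶠ t in 𝓝[>] (0 : ℝ), t < r :=
        nhdsWithin_le_nhds (eventually_lt_nhds hr)
      obtain ⟨t, h1, h2, h3⟩ := (h1.and (h2.and self_mem_nhdsWithin)).exists
      exact ⟨t, h3, h2.le, h1⟩
    have hεsG : ∀ᶠ k in atTop, G (normk B k (a k)) (εs k) ≤ εs (k + 1) := by
      filter_upwards [hclose, haη,
        ((tendsto_add_atTop_iff_nat 1).2 hεs0).eventually_lt_const (hT₂pos t ht)] with k hk hka hkε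
      suffices ik k = 0 by
        rw [hεsS, this]
        exact hεki0 k
      have hpos : ∀ i ≤ ik k, 0 < εki k i := by
        intro i
        induction i with
        | zero =>
          exact fun _ => (hGpos _ _ (hη.trans_le hka) (hεspos k)).trans_le (hεki0 k)
        | succ i ih =>
          intro hi
          rw [hεkiS k i hi]
          exact hT₂pos _ (ih (Nat.le_of_succ_le hi))
      by_contra hne
      obtain ⟨j, hj⟩ := Nat.exists_eq_succ_of_ne_zero hne
      have hjlt : j < ik k := by omega
      have hjpos := hpos j hjlt.le
      obtain ⟨a', ha', hlt⟩ := hnull k j hjlt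
      rw [hεsS, hj, Nat.succ_eq_add_one, hεkiS k j hjlt] at hkε
      rcases le_total t (εki k j) with hle | hle
      · exact (hT₂mono ht hjpos hle).not_gt hkε
      · have h1 := hsep k (x k) hk _ (hle.trans htr) a' ha'
        have h2 := hT₁mono hjpos ht hle
        linarith
    rcases hG with hG | hG
    · obtain ⟨N, hN⟩ := eventually_atTop.1 (haη.and hεsG)
      have hGlim : Tendsto (fun k => G (normk B (k + N) (a (k + N))) (εs (k + N))) atTop (𝓝 0) := by
        have h0 : Tendsto (fun k => εs (k + (N + 1))) atTop (𝓝 0) :=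
          (tendsto_add_atTop_iff_nat (N + 1)).2 hεs0
        exact squeeze_zero
          (fun k => (hGpos _ _ (hη.trans_le (hN _ (Nat.le_add_left N k)).1) (hεspos _)).le)
          (fun k => (hN _ (Nat.le_add_left N k)).2) h0
      have hs := hG (fun k => normk B (k + N) (a (k + N))) (fun k => εs (k + N))
        (fun k => hη.trans_le (hN _ (Nat.le_add_left N k)).1) (fun k => hεspos _) hGlim
      exact (ge_of_tendsto' hs fun k => (hN _ (Nat.le_add_left N k)).1).not_gt hη
    · obtain ⟨t₀, ht₀, hG⟩ := hG (η / 2) (half_pos hη)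
      obtain ⟨N, hN⟩ := eventually_atTop.1
        (haη.and (hεsG.and (hεs0.eventually_lt_const ht₀)))
      have hmono : ∀ k ≥ N, εs N ≤ εs k := by
        intro k hk
        induction k, hk using Nat.le_induction with
        | base => exact le_rfl
        | succ k hk ih =>
          obtain ⟨h1, h2, h3⟩ := hN k hk
          exact ih.trans ((hG _ _ (by linarith) (hεspos k) h3).trans h2)
      exact (ge_of_tendsto hεs0 (eventually_atTop.2 ⟨N, hmono⟩)).not_gt (hεspos N)
  have hiso : (¬ ∃ z : X, Tendsto x atTop (𝓝 z)) →
      ∀ z : X, (∃ φ : ℕ → ℕ, StrictMono φ ∧ Tendsto (fun n => x (φ n)) atTop (𝓝 z)) →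
        ∀ r : ℝ, 0 < r →
          ∃ w : X, (∃ ψ : ℕ → ℕ, StrictMono ψ ∧ Tendsto (fun n => x (ψ n)) atTop (𝓝 w)) ∧
            w ≠ z ∧ dist w z < r := by
    rintro hnot z ⟨φ, hφ, hxφ⟩ r hr
    by_contra! hno
    exact hnot ⟨z, tendsto_of_isolated_clusterPt hcpt hdist0 hr hφ hxφ hno⟩
  refine ⟨hcrit, fun hfin => ?_, hiso⟩
  by_cases hconv : ∃ z : X, Tendsto x atTop (𝓝 z)
  · obtain ⟨z, hz⟩ := hconv
    exact ⟨z, hcrit z ⟨id, strictMono_id, hz⟩, hz⟩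
  obtain ⟨z, -, φ, hφ, hxφ⟩ := hcpt.tendsto_subseq fun n => subset_closure (mem_range_self n)
  obtain ⟨r, hr, hball⟩ := Metric.mem_nhds_iff.1
    ((hfin.subset (sdiff_subset (t := {z}))).isClosed.compl_mem_nhds
      (x := z) fun h => h.2 rfl)
  obtain ⟨w, hw, hwz, hwr⟩ := hiso hconv z ⟨φ, hφ, hxφ⟩ r hr
  refine absurd ⟨⟨?_, hcrit w hw⟩, hwz⟩ (hball hwr)
  obtain ⟨ψ, hψ, hxψ⟩ := hw
  exact hfanti.le_of_tendsto (hlim hψ hxψ) 0
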